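/- arXiv:1309.4624 — 2 statements merged into one kernel-verified Lean document; each statement's English description precedes it below -/
import Mathlib

section
/- Under the stated assumptions, there exists a constant C̃ > 0 independent of f and G such that for every f ∈ Y', every bounded linear functional G ∈ X', and every s ∈ ℕ, |I(G(u)) - I(G(u_s))| ≤ (C̃/μ) · ‖f‖_{Y'} · ‖G‖_{X'} · (Σ_{j ≥ s+1} β_j)², where I(F) := ∫_U F(y) dy denotes integration with respect to the countable product over j ≥ 1 of the uniform probability measures on [-1/2,1/2], and μ = (1 - κ/2)·μ₀. -/
open MeasureTheory

section Perturbation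

variable {X : Type*} [NormedAddCommGroup X] [NormedSpace ℝ X]

/-- A priori bound for solutions of a perturbed identity. -/
theorem norm_le_of_add_apply_eq {B : X →L[ℝ] X} {k : ℝ} (hk : k < 1) (hB : ‖B‖ ≤ k)
    {v h : X} (hv : v + B v = h) : ‖v‖ ≤ ‖h‖ / (1 - k) := by
  rw [le_div_iff₀ (by linarith)]
  have h1 : ‖B v‖ ≤ k * ‖v‖ := B.le_of_opNorm_le hB v
  have h2 : ‖v‖ ≤ ‖h‖ + ‖B v‖ := by
    have : v = h - B v := by rw [← hv]; abel
    calc ‖v‖ = ‖h - B v‖ := by rw [← this]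
      _ ≤ _ := norm_sub_le _ _
  linarith

/-- Solutions of a perturbed identity depend on the perturbation in a Lipschitz way. -/
theorem norm_sub_le_of_add_apply_eq {B B' : X →L[ℝ] X} {k : ℝ} (hk : k < 1)
    (hB : ‖B‖ ≤ k) (hB' : ‖B'‖ ≤ k) {v v' g : X} (hv : v + B v = g) (hv' : v' + B' v' = g) :
    ‖v - v'‖ ≤ ‖B - B'‖ * (‖g‖ / (1 - k)) / (1 - k) := by
  have hd : (v - v') + B (v - v') = -((B - B') v') := by
    rw [map_sub, sub_apply]
    linear_combination (norm := module) hv - hv'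
  have hk' : 0 < 1 - k := by linarith
  refine (norm_le_of_add_apply_eq hk hB hd).trans ?_
  rw [norm_neg]
  gcongr
  exact (B - B').le_of_opNorm_le_of_le le_rfl (norm_le_of_add_apply_eq hk hB' hv')

/-- Symmetric second-difference estimate for solutions of a perturbed identity. -/
theorem norm_add_sub_two_smul_le_of_add_apply_eq {P Q : X →L[ℝ] X} {k q : ℝ} (hk : k < 1)
    (hP : ‖P‖ ≤ k) (hadd : ‖P + Q‖ ≤ k) (hsub : ‖P - Q‖ ≤ k) (hQ : ‖Q‖ ≤ q)
    {v v₁ v₂ g : X} (hv : v + P v = g) (hv₁ : v₁ + (P + Q) v₁ = g)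
    (hv₂ : v₂ + (P - Q) v₂ = g) :
    ‖v₁ + v₂ - (2 : ℝ) • v‖ ≤ 2 * q ^ 2 * ‖g‖ / (1 - k) ^ 3 := by
  have hk' : 0 < 1 - k := by linarith
  have hq : 0 ≤ q := (norm_nonneg Q).trans hQ
  have hd : (v₁ + v₂ - (2 : ℝ) • v) + P (v₁ + v₂ - (2 : ℝ) • v) = -(Q (v₁ - v₂)) := by
    simp only [map_sub, map_add, map_smul, add_apply, sub_apply] at *
    linear_combination (norm := module) hv₁ + hv₂ - (2 : ℝ) • hv
  have hdiff : ‖v₁ - v₂‖ ≤ 2 * q * (‖g‖ / (1 - k)) / (1 - k) := by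
    refine (norm_sub_le_of_add_apply_eq hk hadd hsub hv₁ hv₂).trans ?_
    have : ‖P + Q - (P - Q)‖ ≤ 2 * q := by
      rw [show P + Q - (P - Q) = Q + Q by abel]
      linarith [norm_add_le Q Q]
    gcongr
  refine (norm_le_of_add_apply_eq hk hP hd).trans ?_
  rw [norm_neg]
  have := Q.le_of_opNorm_le_of_le hQ hdiff
  calc ‖Q (v₁ - v₂)‖ / (1 - k) ≤ q * (2 * q * (‖g‖ / (1 - k)) / (1 - k)) / (1 - k) := by gcongr
    _ = _ := by field_simp

end Perturbation

section Cube

/-- The parameter domain `[-1/2, 1/2]^ℕ`. -/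
def parameterCube : Set (ℕ → ℝ) := Set.univ.pi fun _ => Set.Icc (-(1 / 2) : ℝ) (1 / 2)

theorem mem_parameterCube {y : ℕ → ℝ} :
    y ∈ parameterCube ↔ ∀ j, y j ∈ Set.Icc (-(1 / 2) : ℝ) (1 / 2) := by
  simp only [parameterCube, Set.mem_univ_pi]

theorem abs_le_of_mem_parameterCube {y : ℕ → ℝ} (hy : y ∈ parameterCube) (j : ℕ) :
    |y j| ≤ 1 / 2 :=
  abs_le.2 (mem_parameterCube.1 hy j)

theorem measurableSet_parameterCube : MeasurableSet parameterCube :=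
  MeasurableSet.univ_pi fun _ => measurableSet_Icc

/-- Set all coordinates with index at least `s` to zero. -/
def truncateCoord (s : ℕ) (y : ℕ → ℝ) : ℕ → ℝ := fun j => if j < s then y j else 0

/-- Change the sign of all coordinates with index at least `s`. -/
def reflectCoord (s : ℕ) (y : ℕ → ℝ) : ℕ → ℝ := fun j => if j < s then y j else -y j

theorem truncateCoord_mem {s : ℕ} {y : ℕ → ℝ} (hy : y ∈ parameterCube) :
    truncateCoord s y ∈ parameterCube := by
  rw [mem_parameterCube] at *
  intro j
  unfold truncateCoord
  split_ifs
  · exact hy j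
  · norm_num

theorem reflectCoord_mem {s : ℕ} {y : ℕ → ℝ} (hy : y ∈ parameterCube) :
    reflectCoord s y ∈ parameterCube := by
  rw [mem_parameterCube] at *
  intro j
  obtain ⟨h₁, h₂⟩ := hy j
  unfold reflectCoord
  split_ifs
  · exact hy j
  · constructor <;> linarith

theorem continuous_truncateCoord (s : ℕ) : Continuous (truncateCoord s) := by
  refine continuous_pi fun j => ?_
  unfold truncateCoord
  split_ifs <;> fun_prop

theorem measurable_reflectCoord (s : ℕ) : Measurable (reflectCoord s) := by
  refine measurable_pi_lambda _ fun j => ?_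
  unfold reflectCoord
  split_ifs <;> fun_prop

end Cube

section ProductMeasure

variable {ρ : Measure (ℕ → ℝ)}

theorem ae_mem_parameterCube [IsProbabilityMeasure ρ]
    (hρ : ∀ (t : Finset ℕ) (E : ℕ → Set ℝ), (∀ j, MeasurableSet (E j)) →
      ρ {y : ℕ → ℝ | ∀ j ∈ t, y j ∈ E j} =
        ∏ j ∈ t, volume (E j ∩ Set.Icc (-(1/2) : ℝ) (1/2))) :
    ∀ᵐ y ∂ρ, y ∈ parameterCube := by
  simp_rw [mem_parameterCube]
  refine ae_all_iff.2 fun j => ?_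
  have hm : MeasurableSet {y : ℕ → ℝ | y j ∈ Set.Icc (-(1 / 2) : ℝ) (1 / 2)} :=
    measurable_pi_apply j measurableSet_Icc
  refine (mem_ae_iff_prob_eq_one hm).2 ?_
  have h := hρ {j} (fun _ => Set.Icc (-(1 / 2) : ℝ) (1 / 2)) fun _ => measurableSet_Icc
  simp only [Finset.mem_singleton, forall_eq, Finset.prod_singleton, Set.inter_self,
    Real.volume_Icc] at h
  rw [h]
  norm_num

theorem measurePreserving_reflectCoord
    (hρ : ∀ (t : Finset ℕ) (E : ℕ → Set ℝ), (∀ j, MeasurableSet (E j)) →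
      ρ {y : ℕ → ℝ | ∀ j ∈ t, y j ∈ E j} =
        ∏ j ∈ t, volume (E j ∩ Set.Icc (-(1/2) : ℝ) (1/2))) (s : ℕ) :
    MeasurePreserving (reflectCoord s) ρ ρ := by
  refine ⟨measurable_reflectCoord s, ?_⟩
  let ν : Measure ℝ := volume.restrict (Set.Icc (-(1 / 2) : ℝ) (1 / 2))
  have hν : IsProbabilityMeasure ν := ⟨by simp [ν]; norm_num⟩
  have hρν : ρ = Measure.infinitePi fun _ : ℕ => ν := by
    refine Measure.eq_infinitePi _ fun t E hE => ?_
    simp only [ν, Measure.restrict_apply (hE _)]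
    exact hρ t E hE
  conv_rhs => rw [hρν]
  refine Measure.eq_infinitePi _ fun t E hE => ?_
  rw [Measure.map_apply (measurable_reflectCoord s)
    (MeasurableSet.pi t.countable_toSet fun j _ => hE j)]
  have h := hρ t (fun j => if j < s then E j else -E j) fun j => by
    split_ifs
    · exact hE j
    · exact (hE j).neg
  have hset : reflectCoord s ⁻¹' (Set.pi t E) =
      {y : ℕ → ℝ | ∀ j ∈ t, y j ∈ if j < s then E j else -E j} := by
    ext y
    simp only [Set.mem_preimage, Set.mem_pi, Set.mem_ofPred_eq, Finset.mem_coe, reflectCoord]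
    refine forall₂_congr fun j _ => ?_
    split_ifs <;> simp
  rw [hset, h]
  refine Finset.prod_congr rfl fun j _ => ?_
  simp only [ν, Measure.restrict_apply (hE _)]
  split_ifs
  · rfl
  · rw [← Measure.measure_neg volume (E j ∩ _), Set.inter_neg]
    simp

end ProductMeasure

section AffineFamily

variable {E : Type*} [NormedAddCommGroup E] [NormedSpace ℝ E] {B : ℕ → E}

theorem norm_smul_le_of_mem_parameterCube {y : ℕ → ℝ} (hy : y ∈ parameterCube) (j : ℕ) :
    ‖y j • B j‖ ≤ 1 / 2 * ‖B j‖ := by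
  rw [norm_smul, Real.norm_eq_abs]
  gcongr
  exact abs_le_of_mem_parameterCube hy j

theorem summable_smul_of_mem_parameterCube [CompleteSpace E] (hB : Summable fun j => ‖B j‖)
    {y : ℕ → ℝ} (hy : y ∈ parameterCube) : Summable fun j => y j • B j :=
  .of_norm_bounded (hB.mul_left (1 / 2)) (norm_smul_le_of_mem_parameterCube hy)

theorem norm_tsum_smul_le_of_mem_parameterCube (hB : Summable fun j => ‖B j‖) {y : ℕ → ℝ}
    (hy : y ∈ parameterCube) : ‖∑' j, y j • B j‖ ≤ 1 / 2 * ∑' j, ‖B j‖ :=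
  tsum_of_norm_bounded (hB.hasSum.mul_left (1 / 2)) (norm_smul_le_of_mem_parameterCube hy)

theorem continuousOn_tsum_smul [CompleteSpace E] (hB : Summable fun j => ‖B j‖) :
    ContinuousOn (fun y : ℕ → ℝ => ∑' j, y j • B j) parameterCube :=
  continuousOn_tsum (fun j => by fun_prop) (hB.mul_left (1 / 2)) fun j _ hy =>
    norm_smul_le_of_mem_parameterCube hy j

theorem tsum_smul_reflectCoord [CompleteSpace E] (hB : Summable fun j => ‖B j‖)
    {y : ℕ → ℝ} (hy : y ∈ parameterCube) (s : ℕ) :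
    ∑' j, reflectCoord s y j • B j =
      ∑' j, truncateCoord s y j • B j -
        (∑' j, y j • B j - ∑' j, truncateCoord s y j • B j) := by
  have h₁ := summable_smul_of_mem_parameterCube hB hy
  have h₂ := summable_smul_of_mem_parameterCube hB (truncateCoord_mem (s := s) hy)
  rw [← h₁.tsum_sub h₂, ← h₂.tsum_sub (h₁.sub h₂)]
  refine tsum_congr fun j => ?_
  unfold reflectCoord truncateCoord
  split_ifs <;> simp

theorem norm_tsum_smul_sub_truncateCoord_le [CompleteSpace E] (hB : Summable fun j => ‖B j‖)
    {y : ℕ → ℝ} (hy : y ∈ parameterCube) (s : ℕ) :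
    ‖∑' j, y j • B j - ∑' j, truncateCoord s y j • B j‖ ≤
      1 / 2 * ∑' j : {j : ℕ // s ≤ j}, ‖B j.1‖ := by
  have h₁ := summable_smul_of_mem_parameterCube hB hy
  have h₂ := summable_smul_of_mem_parameterCube hB (truncateCoord_mem (s := s) hy)
  rw [← h₁.tsum_sub h₂]
  have hτ : (∑' j : {j : ℕ // s ≤ j}, ‖B j.1‖) =
      ∑' j, Set.indicator {j : ℕ | s ≤ j} (fun j => ‖B j‖) j :=
    tsum_subtype {j : ℕ | s ≤ j} fun j => ‖B j‖
  rw [hτ]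
  refine tsum_of_norm_bounded ((hB.indicator _).hasSum.mul_left (1 / 2)) fun j => ?_
  by_cases hj : j < s
  · simp [truncateCoord, hj]
  · simpa [truncateCoord, hj, not_lt.1 hj] using norm_smul_le_of_mem_parameterCube (B := B) hy j

end AffineFamily

/-- Dimension truncation for a solution map of an affine perturbation of the identity. -/
theorem abs_integral_sub_integral_truncateCoord_le
    {X : Type*} [NormedAddCommGroup X] [NormedSpace ℝ X] [CompleteSpace X]
    {B : ℕ → X →L[ℝ] X} (hB : Summable fun j => ‖B j‖)
    {κ : ℝ} (hκ₂ : κ < 2) (hκ : ∑' j, ‖B j‖ ≤ κ)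
    {g : X} {v : (ℕ → ℝ) → X}
    (hv : ∀ y ∈ parameterCube, v y + (∑' j, y j • B j) (v y) = g)
    {ρ : Measure (ℕ → ℝ)} [IsProbabilityMeasure ρ]
    (hρ : ∀ (t : Finset ℕ) (E : ℕ → Set ℝ), (∀ j, MeasurableSet (E j)) →
      ρ {y : ℕ → ℝ | ∀ j ∈ t, y j ∈ E j} =
        ∏ j ∈ t, volume (E j ∩ Set.Icc (-(1/2) : ℝ) (1/2)))
    (G : X →L[ℝ] ℝ) (s : ℕ) :
    |(∫ y, G (v y) ∂ρ) - ∫ y, G (v (truncateCoord s y)) ∂ρ| ≤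
      1 / 4 * (∑' j : {j : ℕ // s ≤ j}, ‖B j.1‖) ^ 2 * ‖g‖ / (1 - κ / 2) ^ 3 * ‖G‖ := by
  have hk : κ / 2 < 1 := by linarith
  have hk' : 0 < 1 - κ / 2 := by linarith
  have hnorm : ∀ y ∈ parameterCube, ‖∑' j, y j • B j‖ ≤ κ / 2 := fun y hy =>
    (norm_tsum_smul_le_of_mem_parameterCube hB hy).trans (by linarith)
  have hae := ae_mem_parameterCube hρ
  have hcont : ContinuousOn v parameterCube := by
    intro y hy
    refine tendsto_iff_norm_sub_tendsto_zero.2 ?_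
    have hB₀ := tendsto_iff_norm_sub_tendsto_zero.1 (continuousOn_tsum_smul hB y hy)
    refine squeeze_zero' (.of_forall fun _ => norm_nonneg _)
      (eventually_nhdsWithin_of_forall fun z hz =>
        norm_sub_le_of_add_apply_eq hk (hnorm z hz) (hnorm y hy) (hv z hz) (hv y hy)) ?_
    simpa using (hB₀.mul_const (‖g‖ / (1 - κ / 2))).div_const (1 - κ / 2)
  have hint : ∀ w : (ℕ → ℝ) → X, ContinuousOn w parameterCube →
      (∀ y ∈ parameterCube, ‖w y‖ ≤ ‖g‖ / (1 - κ / 2)) → Integrable (fun y => G (w y)) ρ := by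
    intro w hw hwb
    refine Integrable.of_bound (C := ‖G‖ * (‖g‖ / (1 - κ / 2))) ?_ ?_
    · rw [← Measure.restrict_eq_self_of_ae_mem hae]
      exact (G.continuous.comp_continuousOn hw).aestronglyMeasurable measurableSet_parameterCube
    · filter_upwards [hae] with y hy
      exact G.le_of_opNorm_le_of_le le_rfl (hwb y hy)
  have hbound : ∀ y ∈ parameterCube, ‖v y‖ ≤ ‖g‖ / (1 - κ / 2) := fun y hy =>
    norm_le_of_add_apply_eq hk (hnorm y hy) (hv y hy)
  have hi := hint v hcont hbound
  have hit := hint (fun y => v (truncateCoord s y))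
    (hcont.comp (continuous_truncateCoord s).continuousOn fun _ => truncateCoord_mem)
    fun y hy => hbound _ (truncateCoord_mem hy)
  have hR := measurePreserving_reflectCoord hρ s
  have hir : Integrable (fun y => G (v (reflectCoord s y))) ρ :=
    hR.integrable_comp_of_integrable hi
  have hR_eq : ∫ y, G (v (reflectCoord s y)) ∂ρ = ∫ y, G (v y) ∂ρ := by
    have h := integral_map (μ := ρ) hR.measurable.aemeasurable (f := fun y => G (v y))
      (by rw [hR.map_eq]; exact hi.aestronglyMeasurable)
    rw [hR.map_eq] at h
    exact h.symm
  have hsecond : (∫ y, G (v y) ∂ρ) - ∫ y, G (v (truncateCoord s y)) ∂ρ =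
      1 / 2 * ∫ y, G (v y + v (reflectCoord s y) - (2 : ℝ) • v (truncateCoord s y)) ∂ρ := by
    simp only [map_sub, map_add, map_smul, smul_eq_mul]
    have hadd := integral_sub (hi.add hir) (hit.const_mul 2)
    simp only [Pi.add_apply] at hadd
    rw [hadd, integral_add hi hir, integral_const_mul, hR_eq]
    ring
  set τ := ∑' j : {j : ℕ // s ≤ j}, ‖B j.1‖
  have hpt : ∀ᵐ y ∂ρ,
      ‖G (v y + v (reflectCoord s y) - (2 : ℝ) • v (truncateCoord s y))‖ ≤
        ‖G‖ * (2 * (1 / 2 * τ) ^ 2 * ‖g‖ / (1 - κ / 2) ^ 3) := by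
    filter_upwards [hae] with y hy
    refine G.le_of_opNorm_le_of_le le_rfl ?_
    have hty := truncateCoord_mem (s := s) hy
    have hry := reflectCoord_mem (s := s) hy
    have hrn := hnorm _ hry
    have hrv := hv _ hry
    rw [tsum_smul_reflectCoord hB hy] at hrn hrv
    refine norm_add_sub_two_smul_le_of_add_apply_eq hk (hnorm _ hty) ?_ hrn
      (norm_tsum_smul_sub_truncateCoord_le hB hy s) (hv _ hty) ?_ hrv
    · rw [add_sub_cancel]
      exact hnorm y hy
    · rw [add_sub_cancel]
      exact hv y hy
  have hI := norm_integral_le_of_norm_le_const hpt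
  rw [probReal_univ, mul_one, Real.norm_eq_abs] at hI
  rw [hsecond, abs_mul, abs_of_pos (by norm_num : (0 : ℝ) < 1 / 2)]
  calc _ ≤ 1 / 2 * (‖G‖ * (2 * (1 / 2 * τ) ^ 2 * ‖g‖ / (1 - κ / 2) ^ 3)) := by gcongr
    _ = _ := by ring

section InfSup

variable {X Y : Type*} [NormedAddCommGroup X] [NormedSpace ℝ X]
  [NormedAddCommGroup Y] [NormedSpace ℝ Y]

/-- The inf-sup condition bounds a bilinear form from below. -/
theorem mul_norm_le_norm_apply_of_infSup {a : X →L[ℝ] Y →L[ℝ] ℝ} {m : ℝ} (hm : 0 < m)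
    (h : (⨅ v : {v : X // v ≠ 0}, ⨆ w : {w : Y // w ≠ 0},
        a v.1 w.1 / (‖v.1‖ * ‖w.1‖)) ≥ m) (v : X) : m * ‖v‖ ≤ ‖a v‖ := by
  rcases eq_or_ne v 0 with rfl | hv
  · simp
  have hbdd : BddBelow (Set.range fun v : {v : X // v ≠ 0} => ⨆ w : {w : Y // w ≠ 0},
      a v.1 w.1 / (‖v.1‖ * ‖w.1‖)) := by
    by_contra hn
    have := Real.sInf_of_not_bddBelow hn
    rw [iInf, this] at h
    linarith
  have hv' : 0 < ‖v‖ := norm_pos_iff.2 hv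
  rw [← le_div_iff₀ hv']
  refine h.le.trans ((ciInf_le hbdd ⟨v, hv⟩).trans (Real.iSup_le (fun w => ?_) (by positivity)))
  have hw : 0 < ‖w.1‖ := norm_pos_iff.2 w.2
  rw [div_le_div_iff₀ (by positivity) hv']
  have := (le_abs_self _).trans ((a v).le_opNorm w.1)
  calc a v w.1 * ‖v‖ ≤ ‖a v‖ * ‖w.1‖ * ‖v‖ := by gcongr
    _ = _ := by ring

/-- The weak form of an affine parametric problem, rewritten as a perturbation of the identity
by means of the inverse `T` of the nominal operator. -/
theorem add_tsum_smul_comp_apply_eq [CompleteSpace X]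
    {A₀ : X →L[ℝ] Y →L[ℝ] ℝ} {A : ℕ → X →L[ℝ] Y →L[ℝ] ℝ} {T : (Y →L[ℝ] ℝ) →L[ℝ] X}
    (hT₁ : ∀ v : X, T (A₀ v) = v) (hT₂ : ∀ g : Y →L[ℝ] ℝ, A₀ (T g) = g)
    {y : ℕ → ℝ} (hy : Summable fun j => y j • T.comp (A j)) {v : X} {f : Y →L[ℝ] ℝ}
    (hv : ∀ w : Y, A₀ v w + ∑' j, y j * A j v w = f w) :
    v + (∑' j, y j • T.comp (A j)) v = T f := by
  rw [← hT₁ (v + _)]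
  congr 1
  ext w
  rw [map_add, add_apply, ← hv w]
  congr 1
  let L : (X →L[ℝ] X) →L[ℝ] ℝ :=
    (ContinuousLinearMap.apply ℝ ℝ w).comp (A₀.comp (ContinuousLinearMap.apply ℝ X v))
  have h := (L.hasSum hy.hasSum).tsum_eq
  simpa [L, hT₂] using h.symm

end InfSup



/-- **Dimension truncation error for the integrated functional.**
`ρ` is the countable product over `j ∈ ℕ` of the uniform probability measures
on `[-1/2, 1/2]` (characterized by its values on measurable cylinders).
There is a constant `C̃ > 0`, independent of `f` and `G`, such that for every
`f ∈ Y'`, every bounded linear functional `G ∈ X'` and every `s ∈ ℕ`,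
`|I(G(u)) - I(G(u_s))| ≤ (C̃/μ) ‖f‖_{Y'} ‖G‖_{X'} (∑_{j≥s+1} β_j)²`, with
`μ = (1 - κ/2) μ₀` and `β_j = ‖A₀⁻¹ A_j‖`. -/
theorem integrated_dimension_truncation
    {X Y : Type*} [NormedAddCommGroup X] [NormedSpace ℝ X] [CompleteSpace X]
    [TopologicalSpace.SeparableSpace X]
    [NormedAddCommGroup Y] [NormedSpace ℝ Y] [CompleteSpace Y]
    [TopologicalSpace.SeparableSpace Y]
    (A₀ : X →L[ℝ] Y →L[ℝ] ℝ) (A : ℕ → X →L[ℝ] Y →L[ℝ] ℝ)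
    (T : (Y →L[ℝ] ℝ) →L[ℝ] X)
    (hT₁ : ∀ v : X, T (A₀ v) = v) (hT₂ : ∀ g : Y →L[ℝ] ℝ, A₀ (T g) = g)
    (μ₀ : ℝ) (hμ₀ : 0 < μ₀)
    (hinfsup₁ : (⨅ v : {v : X // v ≠ 0}, ⨆ w : {w : Y // w ≠ 0},
        A₀ v.1 w.1 / (‖v.1‖ * ‖w.1‖)) ≥ μ₀)
    (hinfsup₂ : (⨅ w : {w : Y // w ≠ 0}, ⨆ v : {v : X // v ≠ 0},
        A₀ v.1 w.1 / (‖v.1‖ * ‖w.1‖)) ≥ μ₀)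
    (κ : ℝ) (hκ₀ : 0 < κ) (hκ₂ : κ < 2)
    (hβsum : Summable (fun j => ‖T.comp (A j)‖))
    (hκ : (∑' j, ‖T.comp (A j)‖) ≤ κ)
    -- `u f y` is the solution of the parametric problem with right hand side `f`
    (u : (Y →L[ℝ] ℝ) → (ℕ → ℝ) → X)
    (hu : ∀ (f : Y →L[ℝ] ℝ) (y : ℕ → ℝ),
      (∀ j, y j ∈ Set.Icc (-(1/2) : ℝ) (1/2)) →
      ∀ w : Y, A₀ (u f y) w + ∑' j, y j * A j (u f y) w = f w)
    -- `ρ`: the countable product of uniform probability measures on `[-1/2,1/2]`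
    (ρ : Measure (ℕ → ℝ)) [IsProbabilityMeasure ρ]
    (hρ : ∀ (t : Finset ℕ) (E : ℕ → Set ℝ), (∀ j, MeasurableSet (E j)) →
      ρ {y : ℕ → ℝ | ∀ j ∈ t, y j ∈ E j} =
        ∏ j ∈ t, volume (E j ∩ Set.Icc (-(1/2) : ℝ) (1/2))) :
    ∃ C : ℝ, 0 < C ∧
      ∀ (f : Y →L[ℝ] ℝ) (G : X →L[ℝ] ℝ) (s : ℕ),
        |(∫ y, G (u f y) ∂ρ) -
            ∫ y, G (u f (fun j => if j < s then y j else 0)) ∂ρ| ≤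
          C / ((1 - κ / 2) * μ₀) * ‖f‖ * ‖G‖ *
            (∑' j : {j : ℕ // s ≤ j}, ‖T.comp (A j.1)‖) ^ 2 := by
  have hk' : 0 < 1 - κ / 2 := by linarith
  refine ⟨1 / 4 / (1 - κ / 2) ^ 2, by positivity, fun f G s => ?_⟩
  have hTf : ‖T f‖ ≤ ‖f‖ / μ₀ := by
    rw [le_div_iff₀ hμ₀, mul_comm]
    simpa [hT₂] using mul_norm_le_norm_apply_of_infSup hμ₀ hinfsup₁ (T f)
  refine (abs_integral_sub_integral_truncateCoord_le hβsum hκ₂ hκ (g := T f) (v := u f)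
    (fun y hy => add_tsum_smul_comp_apply_eq hT₁ hT₂
      (summable_smul_of_mem_parameterCube hβsum hy) (hu f y (mem_parameterCube.1 hy)))
    hρ G s).trans ?_
  calc _ ≤ 1 / 4 * (∑' j : {j : ℕ // s ≤ j}, ‖T.comp (A j.1)‖) ^ 2 * (‖f‖ / μ₀) /
        (1 - κ / 2) ^ 3 * ‖G‖ := by gcongr
    _ = _ := by field_simp
end

section
/- Let b be a prime, α ≥ 2 and m, d ≥ 1 integers, P ∈ 𝔽_b[x] irreducible with deg(P) = m, and let (γ̃_v)_{∅≠v⊆{1,…,d}} be positive real numbers. Then there exists a generating vector q* = (1, q₂*, …, q_d*) ∈ G_{b,m}^d such that for all λ ∈ (1/α, 1], E_d(q*) ≤ ( (2/(b^m − 1)) · Σ_{∅≠v⊆{1,…,d}} γ̃_v^λ · ((b−1)/(b^{αλ} − b))^{|v|} )^{1/λ}, where E_d(q) := Σ_{∅≠v⊆{1,…,d}} γ̃_v · Σ_{ℓ_v ∈ D_v*(q)} b^{−α·μ₁(ℓ_v)}. -/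
/-- `mu1 b k` is the number of digits in the base-`b` expansion of `k`
(with `mu1 b 0 = 0`). -/
def mu1 (b k : ℕ) : ℕ := if k = 0 then 0 else Nat.log b k + 1

/-- `truncPoly b m k` is the polynomial `κ₀ + κ₁ x + ⋯ + κ_{m-1} x^{m-1}`
over `𝔽_b = ZMod b` formed from the first `m` base-`b` digits
`κ_i = k / b^i % b` of `k`. -/
noncomputable def truncPoly (b m k : ℕ) : Polynomial (ZMod b) :=
  ∑ i ∈ Finset.range m, Polynomial.C ((k / b ^ i % b : ℕ) : ZMod b) * Polynomial.X ^ i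

/-- The quality criterion
`E_d(q) = ∑_{∅≠v⊆{1:d}} γ̃_v ∑_{ℓ_v ∈ D_v*(q)} b^{-α μ₁(ℓ_v)}`, where
`D_v*(q)` consists of the vectors of positive integers `(ℓ_j)_{j∈v}` (encoded
as functions `ℓ : Fin d → ℕ` vanishing outside `v`) with
`∑_{j∈v} tr_m(ℓ_j)·q_j ≡ 0 (mod P)`, and `μ₁(ℓ_v) = ∑_{j∈v} μ₁(ℓ_j)`. -/
noncomputable def Ecrit (b α m d : ℕ) (P : Polynomial (ZMod b))
    (γ : Finset (Fin d) → ℝ) (q : Fin d → Polynomial (ZMod b)) : ℝ :=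
  ∑ v ∈ (Finset.univ : Finset (Finset (Fin d))).filter (· ≠ ∅),
    γ v *
      ∑' ℓ : {ℓ : Fin d → ℕ //
          (∀ j ∈ v, 0 < ℓ j) ∧ (∀ j ∉ v, ℓ j = 0) ∧
          P ∣ ∑ j ∈ v, truncPoly b m (ℓ j) * q j},
        ((b : ℝ) ^ (α * ∑ j ∈ v, mu1 b (ℓ.1 j)))⁻¹

open scoped ENNReal

section Digits

variable {b m : ℕ}

theorem coeff_truncPoly (k i : ℕ) :
    (truncPoly b m k).coeff i = if i < m then ((k / b ^ i % b : ℕ) : ZMod b) else 0 := by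
  simp [truncPoly, Polynomial.finsetSum_coeff, Polynomial.coeff_X_pow]

theorem degree_truncPoly_lt (k : ℕ) : (truncPoly b m k).degree < (m : WithBot ℕ) := by
  rw [Polynomial.degree_lt_iff_coeff_zero]
  intro i hi
  rw [coeff_truncPoly, if_neg (not_lt.2 hi)]

theorem mod_pow_eq_of_digits_eq {k k' : ℕ} :
    ∀ m : ℕ, (∀ i < m, k / b ^ i % b = k' / b ^ i % b) → k % b ^ m = k' % b ^ m
  | 0, _ => by simp [Nat.mod_one]
  | m + 1, h => by
    rw [Nat.mod_pow_succ, Nat.mod_pow_succ, h m m.lt_succ_self,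
      mod_pow_eq_of_digits_eq m fun i hi => h i (hi.trans m.lt_succ_self)]

theorem mod_eq_of_truncPoly_eq {k k' : ℕ}
    (h : truncPoly b m k = truncPoly b m k') : k % b ^ m = k' % b ^ m := by
  refine mod_pow_eq_of_digits_eq m fun i hi => ?_
  have hc := congrArg (fun p => p.coeff i) h
  simp only [coeff_truncPoly, if_pos hi] at hc
  simpa using (ZMod.natCast_eq_natCast_iff' _ _ _).1 hc

theorem truncPoly_zero : truncPoly b m 0 = 0 := by
  simp [truncPoly]

theorem truncPoly_one (hb : 1 < b) (hm : 1 ≤ m) : truncPoly b m 1 = 1 := by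
  ext i
  rw [coeff_truncPoly, Polynomial.coeff_one]
  rcases Nat.eq_zero_or_pos i with rfl | hi
  · simp [Nat.mod_eq_of_lt hb, Nat.lt_of_lt_of_le Nat.zero_lt_one hm]
  · rw [Nat.div_eq_of_lt (Nat.one_lt_pow hi.ne' hb)]
    simp [hi.ne']

theorem truncPoly_ne_zero {k : ℕ} (hk : ¬ b ^ m ∣ k) : truncPoly b m k ≠ 0 := by
  intro h
  rw [← truncPoly_zero (b := b) (m := m)] at h
  exact hk (Nat.dvd_of_mod_eq_zero (by simpa using mod_eq_of_truncPoly_eq h))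

theorem mu1_mul_pow (hb : 1 < b) {k : ℕ} (hk : k ≠ 0) : mu1 b (k * b ^ m) = mu1 b k + m := by
  have hbm : b ^ m ≠ 0 := pow_ne_zero _ (by omega)
  rw [mu1, mu1, if_neg hk, if_neg (mul_ne_zero hk hbm)]
  clear hbm
  induction m with
  | zero => simp
  | succ m ih =>
    rw [pow_succ, ← mul_assoc, Nat.log_mul_base hb (mul_ne_zero hk (pow_ne_zero _ (by omega)))]
    omega

end Digits

/-- The generating sum `∑_{k ≥ 1} r^{μ₁(k)}`. -/
noncomputable def digitSum (b : ℕ) (r : ℝ≥0∞) : ℝ≥0∞ :=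
  ∑' k : ℕ, if 0 < k then r ^ mu1 b k else 0

theorem digitSum_le {b : ℕ} (hb : 1 < b) (r : ℝ≥0∞) :
    digitSum b r ≤ ((b - 1 : ℕ) : ℝ≥0∞) * r * (1 - b * r)⁻¹ := by
  have partial_sum (n : ℕ) :
      ∑ k ∈ Finset.range (b ^ n), (if 0 < k then r ^ mu1 b k else 0) =
        ((b - 1 : ℕ) : ℝ≥0∞) * r * ∑ i ∈ Finset.range n, (b * r) ^ i := by
    induction n with
    | zero => simp
    | succ n ih =>
      have hle : b ^ n ≤ b ^ (n + 1) := Nat.pow_le_pow_right (by omega) n.le_succ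
      rw [← Finset.sum_range_add_sum_Ico _ hle, ih, Finset.sum_range_succ, mul_add]
      congr 1
      have hconst : ∀ k ∈ Finset.Ico (b ^ n) (b ^ (n + 1)),
          (if 0 < k then r ^ mu1 b k else 0) = r ^ (n + 1) := by
        intro k hk
        rw [Finset.mem_Ico] at hk
        have hpos : 0 < k := lt_of_lt_of_le (pow_pos (by omega) n) hk.1
        rw [if_pos hpos, mu1, if_neg hpos.ne', Nat.log_eq_of_pow_le_of_lt_pow hk.1 hk.2]
      rw [Finset.sum_congr rfl hconst, Finset.sum_const, Nat.card_Ico, nsmul_eq_mul,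
        show b ^ (n + 1) - b ^ n = (b - 1) * b ^ n by
          rw [Nat.sub_mul, one_mul, pow_succ, mul_comm]]
      push_cast
      ring
  rw [digitSum, ENNReal.tsum_eq_iSup_nat' (tendsto_pow_atTop_atTop_of_one_lt hb)]
  refine iSup_le fun n => ?_
  rw [partial_sum, ← ENNReal.tsum_geometric]
  gcongr
  exact ENNReal.sum_le_tsum _

theorem tsum_dvd_le {b : ℕ} (hb : 1 < b) (m : ℕ) (r : ℝ≥0∞) :
    ∑' k : ℕ, (if 0 < k then r ^ mu1 b k else 0) * (if b ^ m ∣ k then 1 else 0) ≤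
      r ^ m * digitSum b r := by
  have hbm : 0 < b ^ m := pow_pos (by omega) m
  have hinj : Function.Injective fun k : ℕ => k * b ^ m :=
    fun x y h => Nat.eq_of_mul_eq_mul_right hbm h
  rw [digitSum, ← ENNReal.tsum_mul_left, ← hinj.tsum_eq]
  · refine ENNReal.tsum_le_tsum fun k => ?_
    rcases Nat.eq_zero_or_pos k with rfl | hk
    · simp
    · simp only [Nat.mul_pos_iff_of_pos_right hbm, hk, if_true, dvd_mul_left, mul_one,
        mu1_mul_pow hb hk.ne', pow_add, mul_comm, le_refl]
  · intro k hk
    by_cases h : b ^ m ∣ k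
    · obtain ⟨c, rfl⟩ := h
      exact ⟨c, mul_comm _ _⟩
    · simp [h] at hk

theorem ENNReal.tsum_pi_prod {β : Type*} :
    ∀ {d : ℕ} (f : Fin d → β → ℝ≥0∞), ∑' x : Fin d → β, ∏ i, f i (x i) = ∏ i, ∑' y, f i y
  | 0, f => by simp
  | d + 1, f => by
    rw [← (Fin.consEquiv fun _ : Fin (d + 1) => β).tsum_eq, ENNReal.tsum_prod',
      Fin.prod_univ_succ, ← ENNReal.tsum_pi_prod fun i : Fin d => f i.succ,
      ← ENNReal.tsum_mul_right]
    refine tsum_congr fun y => ?_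
    rw [← ENNReal.tsum_mul_left]
    refine tsum_congr fun x => ?_
    simp [Fin.consEquiv, Fin.prod_univ_succ]

theorem ENNReal.sum_rpow_le {ι : Type*} (s : Finset ι) (f : ι → ℝ≥0∞) {l : ℝ} (h0 : 0 < l)
    (h1 : l ≤ 1) : (∑ i ∈ s, f i) ^ l ≤ ∑ i ∈ s, f i ^ l := by
  classical
  induction s using Finset.induction_on with
  | empty => simp [h0]
  | insert a s ha ih =>
    rw [Finset.sum_insert ha, Finset.sum_insert ha]
    exact (ENNReal.rpow_add_le_add_rpow _ _ h0.le h1).trans (by gcongr)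

theorem ENNReal.tsum_rpow_le {ι : Type*} (f : ι → ℝ≥0∞) {l : ℝ} (h0 : 0 < l) (h1 : l ≤ 1) :
    (∑' i, f i) ^ l ≤ ∑' i, f i ^ l := by
  rw [← ENNReal.le_rpow_inv_iff h0, ENNReal.tsum_eq_iSup_sum]
  refine iSup_le fun s => ?_
  rw [ENNReal.le_rpow_inv_iff h0]
  exact (ENNReal.sum_rpow_le s f h0 h1).trans (ENNReal.sum_le_tsum s)

section DualSum

variable {b m d : ℕ} {P : Polynomial (ZMod b)}

/-- The sum `∑_{ℓ ∈ D_v*(q)} r^{μ₁(ℓ)}` over the dual set without zero components. -/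
noncomputable def dualSum (b m d : ℕ) (P : Polynomial (ZMod b)) (r : ℝ≥0∞)
    (v : Finset (Fin d)) (q : Fin d → Polynomial (ZMod b)) : ℝ≥0∞ :=
  ∑' ℓ : {ℓ : Fin d → ℕ //
      (∀ j ∈ v, 0 < ℓ j) ∧ (∀ j ∉ v, ℓ j = 0) ∧
      P ∣ ∑ j ∈ v, truncPoly b m (ℓ j) * q j},
    r ^ ∑ j ∈ v, mu1 b (ℓ.1 j)

theorem dualSum_rpow_le (r : ℝ≥0∞) (v : Finset (Fin d)) (q : Fin d → Polynomial (ZMod b))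
    {l : ℝ} (h0 : 0 < l) (h1 : l ≤ 1) :
    dualSum b m d P r v q ^ l ≤ dualSum b m d P (r ^ l) v q := by
  refine (ENNReal.tsum_rpow_le _ h0 h1).trans_eq (tsum_congr fun ℓ => ?_)
  rw [← ENNReal.rpow_natCast, ← ENNReal.rpow_natCast, ← ENNReal.rpow_mul, ← ENNReal.rpow_mul,
    mul_comm]

theorem dualSum_mono (r : ℝ≥0∞) {v : Finset (Fin d)} {q q' : Fin d → Polynomial (ZMod b)}
    (h : ∀ ℓ : Fin d → ℕ, P ∣ ∑ j ∈ v, truncPoly b m (ℓ j) * q j →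
      P ∣ ∑ j ∈ v, truncPoly b m (ℓ j) * q' j) :
    dualSum b m d P r v q ≤ dualSum b m d P r v q' :=
  ENNReal.tsum_mono_subtype (fun ℓ : Fin d → ℕ => r ^ ∑ j ∈ v, mu1 b (ℓ j))
    fun ℓ hℓ => ⟨hℓ.1, hℓ.2.1, h ℓ hℓ.2.2⟩

theorem dualSum_congr (r : ℝ≥0∞) {v : Finset (Fin d)} {q q' : Fin d → Polynomial (ZMod b)}
    (h : ∀ i ∈ v, q i = q' i) : dualSum b m d P r v q = dualSum b m d P r v q' := by
  have hs (ℓ : Fin d → ℕ) : ∑ j ∈ v, truncPoly b m (ℓ j) * q j =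
      ∑ j ∈ v, truncPoly b m (ℓ j) * q' j :=
    Finset.sum_congr rfl fun i hi => by rw [h i hi]
  exact le_antisymm (dualSum_mono r fun ℓ => (hs ℓ ▸ id)) (dualSum_mono r fun ℓ => (hs ℓ ▸ id))

/-- A nontrivial linear congruence modulo `P` has at most one solution of degree less than `m`. -/
theorem card_solutions_le (hb : b.Prime) (hP : Irreducible P) (hPdeg : P.natDegree = m)
    (t : ℕ) (s : Polynomial (ZMod b))
    [DecidablePred fun k : ℕ => P ∣ truncPoly b m t * truncPoly b m k + s] :
    ((Finset.Ico 1 (b ^ m)).filter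
      fun k => P ∣ truncPoly b m t * truncPoly b m k + s).card ≤
      1 + if b ^ m ∣ t then b ^ m - 1 else 0 := by
  have := Fact.mk hb
  split_ifs with ht
  · refine (Finset.card_filter_le _ _).trans ?_
    simp
  · have hdvd (p : Polynomial (ZMod b)) (hp : p.degree < (m : WithBot ℕ)) (h : P ∣ p) :
        p = 0 := by
      refine Polynomial.eq_zero_of_dvd_of_degree_lt h ?_
      rwa [Polynomial.degree_eq_natDegree hP.ne_zero, hPdeg]
    rw [add_zero, Finset.card_le_one]
    intro k hk k' hk'
    simp only [Finset.mem_filter, Finset.mem_Ico] at hk hk'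
    have h := dvd_sub hk.2 hk'.2
    rw [add_sub_add_right_eq_sub, ← mul_sub] at h
    rcases hP.prime.dvd_or_dvd h with h | h
    · exact absurd (hdvd _ (degree_truncPoly_lt t) h) (truncPoly_ne_zero ht)
    · have := mod_eq_of_truncPoly_eq (sub_eq_zero.1 (hdvd _ (lt_of_le_of_lt
        (Polynomial.degree_sub_le _ _)
        (max_lt (degree_truncPoly_lt k) (degree_truncPoly_lt k'))) h))
      rwa [Nat.mod_eq_of_lt hk.1.2, Nat.mod_eq_of_lt hk'.1.2] at this

theorem sum_dualSum_update_le (hb : b.Prime) (hP : Irreducible P) (hPdeg : P.natDegree = m)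
    (r : ℝ≥0∞) (v : Finset (Fin d)) (q : Fin d → Polynomial (ZMod b)) {j : Fin d} (hj : j ∈ v) :
    ∑ k ∈ Finset.Ico 1 (b ^ m), dualSum b m d P r v (Function.update q j (truncPoly b m k)) ≤
      (1 + ((b ^ m - 1 : ℕ) : ℝ≥0∞) * r ^ m) * digitSum b r ^ v.card := by
  classical
  set N : ℝ≥0∞ := ((b ^ m - 1 : ℕ) : ℝ≥0∞) with hN
  let φ : Fin d → ℕ → ℝ≥0∞ := fun i k =>
    (if i ∈ v then (if 0 < k then r ^ mu1 b k else 0) else if k = 0 then 1 else 0) *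
      (if i = j then 1 + N * (if b ^ m ∣ k then 1 else 0) else 1)
  have hpoint (ℓ : Fin d → ℕ) :
      ∑ k ∈ Finset.Ico 1 (b ^ m), Set.indicator {ℓ : Fin d → ℕ |
        (∀ j ∈ v, 0 < ℓ j) ∧ (∀ j ∉ v, ℓ j = 0) ∧
        P ∣ ∑ i ∈ v, truncPoly b m (ℓ i) * Function.update q j (truncPoly b m k) i}
        (fun ℓ => r ^ ∑ j ∈ v, mu1 b (ℓ j)) ℓ ≤ ∏ i, φ i (ℓ i) := by
    by_cases hℓ : (∀ j ∈ v, 0 < ℓ j) ∧ (∀ j ∉ v, ℓ j = 0)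
    · have hsum (k : ℕ) :
          ∑ i ∈ v, truncPoly b m (ℓ i) * Function.update q j (truncPoly b m k) i =
          truncPoly b m (ℓ j) * truncPoly b m k + ∑ i ∈ v.erase j, truncPoly b m (ℓ i) * q i := by
        rw [← Finset.add_sum_erase v _ hj, Function.update_self]
        congr 1
        refine Finset.sum_congr rfl fun i hi => ?_
        rw [Function.update_of_ne (Finset.ne_of_mem_erase hi)]
      have hprod : ∏ i, φ i (ℓ i) = (r ^ ∑ j ∈ v, mu1 b (ℓ j)) *
          (1 + N * (if b ^ m ∣ ℓ j then 1 else 0)) := by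
        simp only [φ, Finset.prod_mul_distrib, Finset.prod_ite_eq', Finset.mem_univ, if_true]
        congr 1
        rw [← Finset.prod_pow_eq_pow_sum, ← Finset.prod_subset (Finset.subset_univ v)]
        · exact Finset.prod_congr rfl fun i hi => by simp [hi, hℓ.1 i hi]
        · intro i _ hi
          simp [hi, hℓ.2 i hi]
      have hmem (k : ℕ) : ((∀ j ∈ v, 0 < ℓ j) ∧ (∀ j ∉ v, ℓ j = 0) ∧
          P ∣ ∑ i ∈ v, truncPoly b m (ℓ i) * Function.update q j (truncPoly b m k) i) ↔
          P ∣ truncPoly b m (ℓ j) * truncPoly b m k +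
            ∑ i ∈ v.erase j, truncPoly b m (ℓ i) * q i := by
        rw [hsum]
        exact ⟨fun h => h.2.2, fun h => ⟨hℓ.1, hℓ.2, h⟩⟩
      simp only [Set.indicator_apply, Set.mem_ofPred_eq, hmem]
      rw [hprod, ← Finset.sum_filter, Finset.sum_const, nsmul_eq_mul, mul_comm]
      gcongr
      refine (Nat.cast_le.2 (card_solutions_le hb hP hPdeg (ℓ j) _)).trans_eq ?_
      push_cast
      rw [hN]
      split_ifs <;> simp
    · refine (Finset.sum_eq_zero fun k _ => ?_).trans_le zero_le
      rw [Set.indicator_of_notMem]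
      rintro ⟨h1, h2, -⟩
      exact hℓ ⟨h1, h2⟩
  have hφ (i : Fin d) : ∑' k, φ i k ≤
      (if i ∈ v then digitSum b r else 1) * (if i = j then 1 + N * r ^ m else 1) := by
    by_cases hij : i = j
    · subst hij
      simp only [φ, hj, if_true, mul_add, mul_one]
      rw [ENNReal.tsum_add]
      refine add_le_add le_rfl ?_
      simp only [mul_left_comm _ N]
      rw [ENNReal.tsum_mul_left]
      gcongr
      rw [mul_comm (digitSum b r)]
      exact tsum_dvd_le hb.one_lt m r
    · by_cases hi : i ∈ v
      · simp [φ, hi, hij, digitSum]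
      · simp [φ, hi, hij]
  calc
    _ = ∑' ℓ : Fin d → ℕ, ∑ k ∈ Finset.Ico 1 (b ^ m), Set.indicator {ℓ : Fin d → ℕ |
        (∀ j ∈ v, 0 < ℓ j) ∧ (∀ j ∉ v, ℓ j = 0) ∧
        P ∣ ∑ i ∈ v, truncPoly b m (ℓ i) * Function.update q j (truncPoly b m k) i}
        (fun ℓ => r ^ ∑ j ∈ v, mu1 b (ℓ j)) ℓ := by
      rw [Summable.tsum_finsetSum fun _ _ => ENNReal.summable]
      refine Finset.sum_congr rfl fun k _ => ?_
      rw [← tsum_subtype]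
      rfl
    _ ≤ ∑' ℓ : Fin d → ℕ, ∏ i, φ i (ℓ i) := ENNReal.tsum_le_tsum hpoint
    _ = ∏ i, ∑' k, φ i k := ENNReal.tsum_pi_prod φ
    _ ≤ ∏ i, (if i ∈ v then digitSum b r else 1) * (if i = j then 1 + N * r ^ m else 1) :=
      Finset.prod_le_prod' fun i _ => hφ i
    _ = _ := by
      rw [Finset.prod_mul_distrib]
      simp [Finset.prod_ite_mem, mul_comm]

/-- The dual set of a one-element index set is smallest for the component `1`. -/
theorem dualSum_singleton_le (r : ℝ≥0∞) (j : Fin d) {q q' : Fin d → Polynomial (ZMod b)}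
    (hq : q j = 1) : dualSum b m d P r {j} q ≤ dualSum b m d P r {j} q' := by
  refine dualSum_mono r fun ℓ h => ?_
  rw [Finset.sum_singleton] at h ⊢
  rw [hq, mul_one] at h
  exact h.mul_right _

end DualSum

section ComponentByComponent

variable {b m d : ℕ} {P : Polynomial (ZMod b)}

/-- The part of the quality criterion contributed by the sets with largest element `j`. -/
noncomputable def levelCrit (b m d : ℕ) (P : Polynomial (ZMod b)) (c : Finset (Fin d) → ℝ≥0∞)
    (r : ℝ≥0∞) (j : Fin d) (q : Fin d → Polynomial (ZMod b)) : ℝ≥0∞ :=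
  ∑ v : Finset (Fin d) with v.max = (j : WithBot (Fin d)), c v * dualSum b m d P r v q

theorem levelCrit_congr (c : Finset (Fin d) → ℝ≥0∞) (r : ℝ≥0∞) {j : Fin d}
    {q q' : Fin d → Polynomial (ZMod b)} (h : ∀ i ≤ j, q i = q' i) :
    levelCrit b m d P c r j q = levelCrit b m d P c r j q' := by
  refine Finset.sum_congr rfl fun v hv => ?_
  rw [dualSum_congr r fun i hi => h i (Finset.le_max_of_eq hi (Finset.mem_filter.1 hv).2)]

theorem sum_nonempty_eq_sum_max {M : Type*} [AddCommMonoid M] (f : Finset (Fin d) → M) :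
    ∑ v : Finset (Fin d) with v ≠ ∅, f v =
      ∑ j : Fin d, ∑ v : Finset (Fin d) with v.max = (j : WithBot (Fin d)), f v := by
  simp only [Finset.sum_filter]
  rw [Finset.sum_comm]
  refine Finset.sum_congr rfl fun v _ => ?_
  rcases v.eq_empty_or_nonempty with rfl | hv
  · simp
  · obtain ⟨a, ha⟩ := Finset.max_of_nonempty hv
    simp [ha, hv.ne_empty, WithBot.coe_inj]

theorem exists_componentwise_minimizer (hb : b.Prime) (hm : 1 ≤ m) (hd : 0 < d)
    (c : Finset (Fin d) → ℝ≥0∞) (r : ℝ≥0∞) :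
    ∃ q : Fin d → Polynomial (ZMod b), q ⟨0, hd⟩ = 1 ∧
      (∀ j, ∃ k ∈ Finset.Ico 1 (b ^ m), q j = truncPoly b m k) ∧
      ∀ j, ∀ k ∈ Finset.Ico 1 (b ^ m),
        levelCrit b m d P c r j q ≤
          levelCrit b m d P c r j (Function.update q j (truncPoly b m k)) := by
  have h1mem : 1 ∈ Finset.Ico 1 (b ^ m) :=
    Finset.mem_Ico.2 ⟨le_rfl, Nat.one_lt_pow (by omega) hb.one_lt⟩
  have key : ∀ n : ℕ, ∃ q : Fin d → Polynomial (ZMod b), q ⟨0, hd⟩ = 1 ∧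
      (∀ j, ∃ k ∈ Finset.Ico 1 (b ^ m), q j = truncPoly b m k) ∧
      ∀ j : Fin d, (j : ℕ) < n → ∀ k ∈ Finset.Ico 1 (b ^ m),
        levelCrit b m d P c r j q ≤
          levelCrit b m d P c r j (Function.update q j (truncPoly b m k)) := by
    intro n
    induction n with
    | zero =>
      exact ⟨fun _ => 1, rfl, fun _ => ⟨1, h1mem, (truncPoly_one hb.one_lt hm).symm⟩, by simp⟩
    | succ n ih =>
      obtain ⟨q, hq0, hqG, hqmin⟩ := ih
      by_cases hn : n < d
      swap
      · exact ⟨q, hq0, hqG, fun j _ => hqmin j (by omega)⟩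
      rcases Nat.eq_zero_or_pos n with rfl | hnpos
      · refine ⟨q, hq0, hqG, fun j hj k _ => ?_⟩
        obtain rfl : j = ⟨0, hd⟩ := Fin.ext (by simpa using hj)
        refine Finset.sum_le_sum fun v hv => ?_
        obtain rfl : v = {⟨0, hd⟩} := by
          have hmax := (Finset.mem_filter.1 hv).2
          refine Finset.eq_singleton_iff_unique_mem.2 ⟨Finset.mem_of_max hmax, fun i hi => ?_⟩
          exact le_antisymm (Finset.le_max_of_eq hi hmax) (Fin.mk_le_of_le_val (Nat.zero_le _))
        gcongr
        exact dualSum_singleton_le r _ hq0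
      · obtain ⟨k₀, hk₀, hmin⟩ := Finset.exists_min_image (Finset.Ico 1 (b ^ m))
          (fun k => levelCrit b m d P c r ⟨n, hn⟩
            (Function.update q ⟨n, hn⟩ (truncPoly b m k))) ⟨1, h1mem⟩
        refine ⟨Function.update q ⟨n, hn⟩ (truncPoly b m k₀), ?_, fun j => ?_, fun j hj k hk => ?_⟩
        · rw [Function.update_of_ne _ _ _, hq0]
          simp [Fin.ext_iff, hnpos.ne]
        · by_cases hj : j = ⟨n, hn⟩
          · subst hj
            exact ⟨k₀, hk₀, Function.update_self ..⟩
          · rw [Function.update_of_ne hj]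
            exact hqG j
        · rcases Nat.lt_succ_iff_lt_or_eq.1 hj with hj | hj
          · have hne (i : Fin d) (hi : i ≤ j) : i ≠ ⟨n, hn⟩ := by
              rintro rfl
              exact absurd hi (not_le.2 (Fin.lt_def.2 hj))
            rw [levelCrit_congr c r (q' := q) fun i hi => Function.update_of_ne (hne i hi) _ _,
              Function.update_comm (hne j le_rfl).symm,
              levelCrit_congr c r (q := Function.update (Function.update q j _) _ _)
                fun i hi => Function.update_of_ne (hne i hi) _ _]
            exact hqmin j hj k hk
          · obtain rfl : j = ⟨n, hn⟩ := Fin.ext hj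
            rw [Function.update_idem]
            exact hmin k hk
  obtain ⟨q, h0, hG, h⟩ := key d
  exact ⟨q, h0, hG, fun j => h j j.2⟩

theorem sum_dualSum_rpow_le (hb : b.Prime) (hm : 1 ≤ m) (hP : Irreducible P)
    (hPdeg : P.natDegree = m) (c : Finset (Fin d) → ℝ≥0∞) (r : ℝ≥0∞)
    {q : Fin d → Polynomial (ZMod b)}
    (hq : ∀ j, ∀ k ∈ Finset.Ico 1 (b ^ m),
      levelCrit b m d P c r j q ≤
        levelCrit b m d P c r j (Function.update q j (truncPoly b m k)))
    {l : ℝ} (h0 : 0 < l) (h1 : l ≤ 1) (hr : r ^ l ≤ (b : ℝ≥0∞)⁻¹) :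
    (∑ v : Finset (Fin d) with v ≠ ∅, c v * dualSum b m d P r v q) ^ l ≤
      2 / ((b ^ m - 1 : ℕ) : ℝ≥0∞) *
        ∑ v : Finset (Fin d) with v ≠ ∅, c v ^ l * digitSum b (r ^ l) ^ v.card := by
  set N : ℝ≥0∞ := ((b ^ m - 1 : ℕ) : ℝ≥0∞) with hN
  have hbm : 1 < b ^ m := Nat.one_lt_pow (by omega) hb.one_lt
  have hN0 : N ≠ 0 := by
    rw [hN, Nat.cast_ne_zero]
    omega
  have hNtop : N ≠ ⊤ := ENNReal.natCast_ne_top _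
  have hfactor : 1 + N * (r ^ l) ^ m ≤ 2 := by
    rw [← one_add_one_eq_two]
    gcongr
    calc N * (r ^ l) ^ m ≤ (b ^ m : ℕ) * ((b : ℝ≥0∞)⁻¹) ^ m := by
          gcongr
          exact Nat.cast_le.2 (Nat.sub_le (b ^ m) 1)
      _ = 1 := by
          rw [Nat.cast_pow, ← mul_pow, ENNReal.mul_inv_cancel
            (Nat.cast_ne_zero.2 hb.ne_zero) (ENNReal.natCast_ne_top _), one_pow]
  have hlevel (j : Fin d) : levelCrit b m d P c r j q ^ l ≤
      2 / N * ∑ v : Finset (Fin d) with v.max = (j : WithBot (Fin d)), c v ^ l * digitSum b (r ^ l) ^ v.card := by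
    rw [mul_comm, ← mul_div_assoc, ENNReal.le_div_iff_mul_le (.inl hN0) (.inl hNtop)]
    calc
      _ = ∑ k ∈ Finset.Ico 1 (b ^ m), levelCrit b m d P c r j q ^ l := by
        rw [Finset.sum_const, Nat.card_Ico, nsmul_eq_mul, mul_comm]
      _ ≤ ∑ k ∈ Finset.Ico 1 (b ^ m),
          levelCrit b m d P c r j (Function.update q j (truncPoly b m k)) ^ l :=
        Finset.sum_le_sum fun k hk => ENNReal.rpow_le_rpow (hq j k hk) h0.le
      _ ≤ ∑ k ∈ Finset.Ico 1 (b ^ m), ∑ v : Finset (Fin d) with v.max = (j : WithBot (Fin d)), c v ^ l *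
          dualSum b m d P (r ^ l) v (Function.update q j (truncPoly b m k)) := by
        refine Finset.sum_le_sum fun k _ => (ENNReal.sum_rpow_le _ _ h0 h1).trans ?_
        refine Finset.sum_le_sum fun v _ => ?_
        rw [ENNReal.mul_rpow_of_nonneg _ _ h0.le]
        gcongr
        exact dualSum_rpow_le r v _ h0 h1
      _ ≤ ∑ v : Finset (Fin d) with v.max = (j : WithBot (Fin d)),
          c v ^ l * (2 * digitSum b (r ^ l) ^ v.card) := by
        rw [Finset.sum_comm]
        refine Finset.sum_le_sum fun v hv => ?_
        rw [← Finset.mul_sum]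
        gcongr
        refine (sum_dualSum_update_le hb hP hPdeg (r ^ l) v q
          (Finset.mem_of_max (Finset.mem_filter.1 hv).2)).trans ?_
        gcongr
      _ = _ := by
        rw [Finset.sum_mul]
        exact Finset.sum_congr rfl fun v _ => by ring
  rw [sum_nonempty_eq_sum_max, sum_nonempty_eq_sum_max, Finset.mul_sum]
  exact (ENNReal.sum_rpow_le _ _ h0 h1).trans (Finset.sum_le_sum fun j _ => hlevel j)

end ComponentByComponent

theorem ofReal_Ecrit_le {b : ℕ} (hb : 0 < b) (α m d : ℕ) (P : Polynomial (ZMod b))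
    {γ : Finset (Fin d) → ℝ} (hγ : ∀ v : Finset (Fin d), v ≠ ∅ → 0 < γ v)
    (q : Fin d → Polynomial (ZMod b)) :
    ENNReal.ofReal (Ecrit b α m d P γ q) ≤
      ∑ v : Finset (Fin d) with v ≠ ∅,
        ENNReal.ofReal (γ v) * dualSum b m d P (((b : ℝ≥0∞) ^ α)⁻¹) v q := by
  have hb' : (b : ℝ≥0∞) ≠ 0 := Nat.cast_ne_zero.2 hb.ne'
  have htsum (v : Finset (Fin d)) :
      (∑' ℓ : {ℓ : Fin d → ℕ //
          (∀ j ∈ v, 0 < ℓ j) ∧ (∀ j ∉ v, ℓ j = 0) ∧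
          P ∣ ∑ j ∈ v, truncPoly b m (ℓ j) * q j},
        ((b : ℝ) ^ (α * ∑ j ∈ v, mu1 b (ℓ.1 j)))⁻¹) =
      (dualSum b m d P (((b : ℝ≥0∞) ^ α)⁻¹) v q).toReal := by
    rw [dualSum, ENNReal.tsum_toReal_eq]
    · refine tsum_congr fun ℓ => ?_
      simp [pow_mul]
    · intro ℓ
      simp [hb']
  simp only [Ecrit, htsum]
  rw [ENNReal.ofReal_sum_of_nonneg]
  · refine Finset.sum_le_sum fun v hv => ?_
    rw [ENNReal.ofReal_mul (hγ v (Finset.mem_filter.1 hv).2).le]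
    gcongr
    exact ENNReal.ofReal_toReal_le
  · intro v hv
    exact mul_nonneg (hγ v (Finset.mem_filter.1 hv).2).le ENNReal.toReal_nonneg

theorem digitSum_le_ofReal {b : ℕ} (hb : 1 < b) {x : ℝ} (hx : 1 < x) :
    digitSum b (((b : ℝ≥0∞) ^ x)⁻¹) ≤ ENNReal.ofReal (((b : ℝ) - 1) / ((b : ℝ) ^ x - b)) := by
  have hb0 : (0 : ℝ) < b := by exact_mod_cast (by omega : 0 < b)
  have hb1 : (1 : ℝ) < b := by exact_mod_cast hb
  have hpow : (b : ℝ) < (b : ℝ) ^ x := by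
    simpa using Real.rpow_lt_rpow_of_exponent_lt hb1 hx
  have hpos : 0 < (b : ℝ) ^ x := hb0.trans hpow
  have hlt : (b : ℝ) * ((b : ℝ) ^ x)⁻¹ < 1 := by
    rw [← div_eq_mul_inv]
    exact (div_lt_one hpos).2 hpow
  have hr : ((b : ℝ≥0∞) ^ x)⁻¹ = ENNReal.ofReal (((b : ℝ) ^ x)⁻¹) := by
    rw [ENNReal.ofReal_inv_of_pos hpos, ← ENNReal.ofReal_rpow_of_pos hb0, ENNReal.ofReal_natCast]
  refine (digitSum_le hb _).trans_eq ?_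
  rw [hr, ← ENNReal.ofReal_natCast b, ← ENNReal.ofReal_natCast (b - 1), ← ENNReal.ofReal_one,
    ← ENNReal.ofReal_mul hb0.le, ← ENNReal.ofReal_sub _ (by positivity),
    ← ENNReal.ofReal_inv_of_pos (by linarith), ← ENNReal.ofReal_mul (by positivity),
    ← ENNReal.ofReal_mul (by positivity), Nat.cast_sub hb.le, Nat.cast_one]
  congr 1
  have h1 : (b : ℝ) ^ x - b ≠ 0 := by linarith
  have h2 : 1 - (b : ℝ) * ((b : ℝ) ^ x)⁻¹ ≠ 0 := by linarith
  rw [mul_assoc, div_eq_mul_inv, ← mul_inv]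
  congr 2
  field_simp


/-- **Component-by-component error bound (Theorem 3.5).**
Let `b` be prime, `α ≥ 2`, `m, d ≥ 1`, `P ∈ 𝔽_b[x]` irreducible of degree
`m`, and let `γ̃_v > 0` for all nonempty `v ⊆ {1:d}`.  Then there is a
generating vector `q* = (1, q₂*, …, q_d*)`, with all components nonzero of
degree `< m`, such that for all `λ ∈ (1/α, 1]`,
`E_d(q*) ≤ (2/(b^m-1) ∑_{∅≠v} γ̃_v^λ ((b-1)/(b^{αλ}-b))^{|v|})^{1/λ}`. -/
theorem cbc_error_bound (b : ℕ) (hb : Nat.Prime b) (α : ℕ) (hα : 2 ≤ α)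
    (m d : ℕ) (hm : 1 ≤ m) (hd : 1 ≤ d)
    (P : Polynomial (ZMod b)) (hP : Irreducible P) (hPdeg : P.natDegree = m)
    (γ : Finset (Fin d) → ℝ) (hγ : ∀ v : Finset (Fin d), v ≠ ∅ → 0 < γ v) :
    ∃ q : Fin d → Polynomial (ZMod b),
      q ⟨0, hd⟩ = 1 ∧
      (∀ j, q j ≠ 0 ∧ (q j).degree < (m : WithBot ℕ)) ∧
      ∀ l : ℝ, 1 / (α : ℝ) < l → l ≤ 1 →
        Ecrit b α m d P γ q ≤
          (2 / ((b : ℝ) ^ m - 1) *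
              ∑ v ∈ (Finset.univ : Finset (Finset (Fin d))).filter (· ≠ ∅),
                γ v ^ l *
                  (((b : ℝ) - 1) / ((b : ℝ) ^ ((α : ℝ) * l) - (b : ℝ))) ^ v.card)
            ^ (1 / l) := by
  have hα0 : (0 : ℝ) < α := by exact_mod_cast (by omega : 0 < α)
  have hb0 : (0 : ℝ) < b := by exact_mod_cast hb.pos
  have hb1 : (1 : ℝ) < b := by exact_mod_cast hb.one_lt
  have hbm : 1 < b ^ m := Nat.one_lt_pow (by omega) hb.one_lt
  have hbm' : (0 : ℝ) < (b : ℝ) ^ m - 1 := by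
    rw [sub_pos]
    exact_mod_cast hbm
  obtain ⟨q, hq0, hqG, hqmin⟩ := exists_componentwise_minimizer (P := P) hb hm hd
    (fun v => ENNReal.ofReal (γ v)) (((b : ℝ≥0∞) ^ α)⁻¹)
  refine ⟨q, hq0, fun j => ?_, fun l hl hl1 => ?_⟩
  · obtain ⟨k, hk, hqk⟩ := hqG j
    rw [Finset.mem_Ico] at hk
    rw [hqk]
    exact ⟨truncPoly_ne_zero (Nat.not_dvd_of_pos_of_lt hk.1 hk.2), degree_truncPoly_lt k⟩
  have hl0 : 0 < l := lt_trans (by positivity) hl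
  have hαl : 1 < (α : ℝ) * l := by
    rw [div_lt_iff₀ hα0] at hl
    linarith
  have hpow : (b : ℝ) < (b : ℝ) ^ ((α : ℝ) * l) := by
    simpa using Real.rpow_lt_rpow_of_exponent_lt hb1 hαl
  have hC : 0 ≤ ((b : ℝ) - 1) / ((b : ℝ) ^ ((α : ℝ) * l) - b) :=
    div_nonneg (by linarith) (by linarith)
  have hr : (((b : ℝ≥0∞) ^ α)⁻¹) ^ l = ((b : ℝ≥0∞) ^ ((α : ℝ) * l))⁻¹ := by
    rw [ENNReal.inv_rpow, ENNReal.rpow_mul, ENNReal.rpow_natCast]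
  have hr_le : (((b : ℝ≥0∞) ^ α)⁻¹) ^ l ≤ (b : ℝ≥0∞)⁻¹ := by
    rw [hr, ENNReal.inv_le_inv]
    simpa using ENNReal.rpow_le_rpow_of_exponent_le
      (by exact_mod_cast hb.one_lt.le : (1 : ℝ≥0∞) ≤ b) hαl.le
  have hterm : ∀ v ∈ (Finset.univ : Finset (Finset (Fin d))).filter (· ≠ ∅),
      0 ≤ γ v ^ l * (((b : ℝ) - 1) / ((b : ℝ) ^ ((α : ℝ) * l) - b)) ^ v.card := fun v hv =>
    mul_nonneg (Real.rpow_nonneg (hγ v (Finset.mem_filter.1 hv).2).le _) (pow_nonneg hC _)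
  have hbase := mul_nonneg (div_nonneg zero_le_two hbm'.le) (Finset.sum_nonneg hterm)
  refine (ENNReal.ofReal_le_ofReal_iff (Real.rpow_nonneg hbase _)).1 ?_
  refine (ofReal_Ecrit_le hb.pos α m d P hγ q).trans ?_
  rw [← ENNReal.ofReal_rpow_of_nonneg hbase (by positivity), one_div,
    ENNReal.le_rpow_inv_iff hl0]
  refine (sum_dualSum_rpow_le hb hm hP hPdeg _ _ hqmin hl0 hl1 hr_le).trans ?_
  rw [ENNReal.ofReal_mul (div_nonneg zero_le_two hbm'.le), ENNReal.ofReal_sum_of_nonneg hterm,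
    ENNReal.ofReal_div_of_pos hbm']
  gcongr with v hv
  · simp
  · rw [ENNReal.ofReal_le_iff_le_toReal (ENNReal.natCast_ne_top _), ENNReal.toReal_natCast,
      Nat.cast_sub hbm.le]
    simp
  · have hγv := hγ v (Finset.mem_filter.1 hv).2
    rw [ENNReal.ofReal_mul (Real.rpow_nonneg hγv.le _), ENNReal.ofReal_pow hC,
      ← ENNReal.ofReal_rpow_of_pos hγv, hr]
    gcongr
    exact digitSum_le_ofReal hb.one_lt hαl
end
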